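/- Any two Curtis tables for the same based complex are equal: if (U, τ) and (U′, τ′) are Curtis tables for a based complex, then U_i = U′_i and τ_i = τ′_i (as partial functions) for every i. -/

import Mathlib

/-- The leading index (an element of `WithBot (Fin m)`, which is `⊥` exactly for the zero
vector) of a vector of the based `𝔽₂`-vector space `Fin m → ZMod 2`, whose ordered basis is
the standard one. -/
def lead {m : ℕ} (v : Fin m → ZMod 2) : WithBot (Fin m) :=
  (Finset.univ.filter fun j => v j ≠ 0).max

/-- `LTset S` is the set of leading indices of the nonzero elements of the subspace `S`. -/
def LTset {m : ℕ} (S : Submodule (ZMod 2) (Fin m → ZMod 2)) : Set (Fin m) :=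
  {j | ∃ v ∈ S, v ≠ 0 ∧ lead v = (j : WithBot (Fin m))}

/-- A based complex `X_0 → X_1 → ⋯ → X_N` of finite-dimensional `𝔽₂`-vector spaces with
ordered bases: `X_i` is modelled as `Fin (n i) → ZMod 2` via its ordered basis, and the
complex is extended by zero spaces in degrees `> N` (so `d_N = 0` holds automatically). -/
structure BasedComplex where
  N : ℕ
  n : ℕ → ℕ
  n_eq_zero : ∀ i, N < i → n i = 0
  d : ∀ i : ℕ, (Fin (n i) → ZMod 2) →ₗ[ZMod 2] (Fin (n (i + 1)) → ZMod 2)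
  d_comp : ∀ i, (d (i + 1)).comp (d i) = 0

namespace BasedComplex

/-- The cycles `ker d_i`. -/
def cyc (C : BasedComplex) (i : ℕ) : Submodule (ZMod 2) (Fin (C.n i) → ZMod 2) :=
  LinearMap.ker (C.d i)

/-- The boundaries `im d_{i-1}`, with the convention `d_{-1} = 0`. -/
def bdry (C : BasedComplex) : ∀ i : ℕ, Submodule (ZMod 2) (Fin (C.n i) → ZMod 2)
  | 0 => ⊥
  | (i + 1) => LinearMap.range (C.d i)

theorem bdry_zero (C : BasedComplex) : C.bdry 0 = ⊥ := rfl

theorem bdry_succ (C : BasedComplex) (i : ℕ) :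
    C.bdry (i + 1) = LinearMap.range (C.d i) := rfl

/-- The boundaries, viewed as a submodule of the cycles. -/
def bdryIn (C : BasedComplex) (i : ℕ) : Submodule (ZMod 2) (C.cyc i) :=
  (C.bdry i).comap (C.cyc i).subtype

/-- The homology `H_i = ker d_i / im d_{i-1}`. -/
abbrev homology (C : BasedComplex) (i : ℕ) :=
  C.cyc i ⧸ C.bdryIn i

end BasedComplex

/-- Given tag data `t`, where `t i k = some j` means that the basis index `k` of `X_i` is
tagged with target the basis index `j` of `X_{i+1}` (i.e. `τ_{i+1}(k) = j`),
`tagImage C t i` is the image of the partial function `τ_i` (which is empty for `i = 0`). -/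
def tagImage (C : BasedComplex) (t : ∀ i, Fin (C.n i) → Option (Fin (C.n (i + 1)))) :
    ∀ i : ℕ, Set (Fin (C.n i))
  | 0 => ∅
  | (i + 1) => {j | ∃ k, t i k = some j}

/-- A Curtis table for a based complex.  Here `t i` encodes the injective partial function
`τ_{i+1}` from the basis indices of `X_i` to the basis indices of `X_{i+1}`
(`t i k = some j` means `τ_{i+1}(k) = j`; the partial function `τ_0` is empty by
convention, and `τ_{N+1}` is automatically empty since `X_{N+1} = 0`). -/
structure CurtisTable (C : BasedComplex) where
  /-- the untagged items in each degree -/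
  U : ∀ i, Set (Fin (C.n i))
  /-- the tags -/
  t : ∀ i, Fin (C.n i) → Option (Fin (C.n (i + 1)))
  /-- the tags form an injective partial function -/
  t_inj : ∀ i k k' j, t i k = some j → t i k' = some j → k = k'
  /-- (i): `U_i` and the image of `τ_i` are disjoint … -/
  disj : ∀ i, Disjoint (U i) (tagImage C t i)
  /-- (i): … and their union is `LT(ker d_i)` -/
  union_eq : ∀ i, U i ∪ tagImage C t i = LTset (C.cyc i)
  /-- (ii): no index is both untagged and in the domain of `τ_{i+1}` -/
  mem_U_not_dom : ∀ i j, j ∈ U i → t i j = none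
  /-- (ii): no index is both in the image of `τ_i` and in the domain of `τ_{i+1}` -/
  mem_tagImage_not_dom : ∀ i j, j ∈ tagImage C t i → t i j = none
  /-- (ii): every basis index is untagged, or in the image of `τ_i`, or in the domain of
  `τ_{i+1}` -/
  cover : ∀ i j, j ∈ U i ∨ j ∈ tagImage C t i ∨ (t i j).isSome
  /-- (iii): if `τ_{i+1}(k) = j` then there is an `x` with leading index `k` such that
  `d_i x ≠ 0` and `d_i x` has leading index `j` -/
  tag_spec : ∀ i k j, t i k = some j →
    ∃ x : Fin (C.n i) → ZMod 2, lead x = (k : WithBot (Fin (C.n i))) ∧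
      C.d i x ≠ 0 ∧ lead (C.d i x) = (j : WithBot (Fin (C.n (i + 1))))

theorem lead_eq_coe_iff {m : ℕ} {v : Fin m → ZMod 2} {k : Fin m} :
    lead v = (k : WithBot (Fin m)) ↔ v k ≠ 0 ∧ ∀ j, k < j → v j = 0 := by
  constructor
  · intro h
    refine ⟨(Finset.mem_filter.mp (Finset.mem_of_max h)).2, fun j hj => ?_⟩
    by_contra hv
    exact absurd (Finset.le_max_of_eq (Finset.mem_filter.mpr ⟨Finset.mem_univ j, hv⟩) h)
      (not_le.mpr hj)
  · rintro ⟨hk, h⟩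
    apply le_antisymm
    · refine Finset.max_le fun j hj => ?_
      by_contra hlt
      exact (Finset.mem_filter.mp hj).2 (h j (by simpa using hlt))
    · exact Finset.le_max (Finset.mem_filter.mpr ⟨Finset.mem_univ k, hk⟩)

theorem exists_lead_eq_coe {m : ℕ} {v : Fin m → ZMod 2} (hv : v ≠ 0) :
    ∃ k : Fin m, lead v = (k : WithBot (Fin m)) := by
  obtain ⟨j, hj⟩ := Function.ne_iff.mp hv
  exact Finset.max_of_mem (Finset.mem_filter.mpr ⟨Finset.mem_univ j, hj⟩)

/-- Over `𝔽₂`, subtracting two vectors with the same leading index lowers the leading index. -/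
theorem lt_of_lead_sub_eq_coe {m : ℕ} {v w : Fin m → ZMod 2} {k l : Fin m}
    (hv : lead v = (k : WithBot (Fin m))) (hw : lead w = (k : WithBot (Fin m)))
    (h : lead (v - w) = (l : WithBot (Fin m))) : l < k := by
  rw [lead_eq_coe_iff] at hv hw h
  by_contra! hle
  apply h.1
  rcases hle.eq_or_lt with rfl | hlt
  · have key : ∀ a b : ZMod 2, a ≠ 0 → b ≠ 0 → a - b = 0 := by decide
    exact key _ _ hv.1 hw.1
  · simp [hv.2 l hlt, hw.2 l hlt]

theorem lead_add_of_lt {m : ℕ} {v w : Fin m → ZMod 2} {k l : Fin m}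
    (hv : lead v = (k : WithBot (Fin m))) (hw : lead w = (l : WithBot (Fin m))) (h : k < l) :
    lead (v + w) = (l : WithBot (Fin m)) := by
  rw [lead_eq_coe_iff] at hv hw ⊢
  refine ⟨by simpa [hv.2 l h] using hw.1, fun j hj => ?_⟩
  simp [hv.2 j (h.trans hj), hw.2 j hj]

namespace CurtisTable

variable {C : BasedComplex}

theorem isSome_iff (T : CurtisTable C) (i : ℕ) (k : Fin (C.n i)) :
    (T.t i k).isSome ↔ k ∉ LTset (C.cyc i) := by
  rw [← T.union_eq i]
  constructor
  · rintro h (hU | hI)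
    · simp [T.mem_U_not_dom i k hU] at h
    · simp [T.mem_tagImage_not_dom i k hI] at h
  · intro h
    rcases T.cover i k with hU | hI | hs
    · exact absurd (Or.inl hU) h
    · exact absurd (Or.inr hI) h
    · exact hs

/-- The leading index of a nonzero boundary `d z` is the tag of some index not exceeding the
leading index of `z`. -/
theorem exists_tag_eq_lead (T : CurtisTable C) (i : ℕ) (k : Fin (C.n i)) :
    ∀ (z : Fin (C.n i) → ZMod 2) (j : Fin (C.n (i + 1))),
      lead z = (k : WithBot (Fin (C.n i))) →
      lead (C.d i z) = (j : WithBot (Fin (C.n (i + 1)))) →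
      ∃ k' ≤ k, T.t i k' = some j := by
  induction k using WellFoundedLT.induction with
  | ind k ih =>
    intro z j hz hj
    have step : ∀ w, lead w = (k : WithBot (Fin (C.n i))) →
        ∀ l : Fin (C.n (i + 1)),
        lead (C.d i (z - w)) = (l : WithBot (Fin (C.n (i + 1)))) →
        ∃ k' < k, T.t i k' = some l := by
      intro w hw l hl
      have hne : z - w ≠ 0 := by
        intro h0
        rw [h0, map_zero, lead_eq_coe_iff] at hl
        exact hl.1 rfl
      obtain ⟨p, hp⟩ := exists_lead_eq_coe hne
      have hpk := lt_of_lead_sub_eq_coe hz hw hp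
      obtain ⟨k', hk', ht⟩ := ih p hpk _ l hp hl
      exact ⟨k', hk'.trans_lt hpk, ht⟩
    by_cases hk : k ∈ LTset (C.cyc i)
    · obtain ⟨w, hw, -, hlw⟩ := hk
      have hdw : C.d i w = 0 := hw
      obtain ⟨k', hk', ht⟩ := step w hlw j (by rwa [map_sub, hdw, sub_zero])
      exact ⟨k', hk'.le, ht⟩
    · obtain ⟨a, ha⟩ := Option.isSome_iff_exists.mp ((T.isSome_iff i k).mpr hk)
      obtain ⟨x, hx, -, hdx⟩ := T.tag_spec i k a ha
      have hdz : C.d i z = C.d i (z - x) + C.d i x := by simp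
      by_cases h0 : C.d i (z - x) = 0
      · rw [hdz, h0, zero_add, hdx] at hj
        exact ⟨k, le_rfl, ha.trans (congrArg some (WithBot.coe_injective hj))⟩
      · obtain ⟨l, hl⟩ := exists_lead_eq_coe h0
        obtain ⟨k', hk', ht⟩ := step x hx l hl
        rcases lt_trichotomy l a with h | h | h
        · rw [hdz, lead_add_of_lt hl hdx h] at hj
          exact ⟨k, le_rfl, ha.trans (congrArg some (WithBot.coe_injective hj))⟩
        · subst h
          exact absurd (T.t_inj i _ _ _ ht ha) hk'.ne
        · rw [hdz, add_comm (C.d i (z - x)), lead_add_of_lt hdx hl h] at hj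
          exact ⟨k', hk'.le, ht.trans (congrArg some (WithBot.coe_injective hj))⟩

theorem t_eq (T T' : CurtisTable C) (i : ℕ) (k : Fin (C.n i)) : T.t i k = T'.t i k := by
  induction k using WellFoundedLT.induction with
  | ind k ih =>
    have hsome : (T.t i k).isSome ↔ (T'.t i k).isSome :=
      (T.isSome_iff i k).trans (T'.isSome_iff i k).symm
    cases h' : T'.t i k with
    | none => simpa [h'] using hsome
    | some j =>
      obtain ⟨x, hx, -, hdx⟩ := T'.tag_spec i k j h'
      obtain ⟨k', hk', ht⟩ := T.exists_tag_eq_lead i k x j hx hdx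
      rcases hk'.eq_or_lt with rfl | hlt
      · exact ht
      · exact absurd (T'.t_inj i _ _ _ ((ih k' hlt).symm.trans ht) h') hlt.ne

theorem U_eq_diff (T : CurtisTable C) (i : ℕ) :
    T.U i = LTset (C.cyc i) \ tagImage C T.t i := by
  rw [← T.union_eq i, Set.union_sdiff_right, (T.disj i).sdiff_eq_left]

end CurtisTable

/-- Any two Curtis tables for the same based complex are equal: the untagged items and the
tags coincide in every degree. -/
theorem curtisTable_unique (C : BasedComplex) (T T' : CurtisTable C) :
    T.U = T'.U ∧ T.t = T'.t := by
  have ht : T.t = T'.t := funext fun i => funext fun k => T.t_eq T' i k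
  refine ⟨funext fun i => ?_, ht⟩
  rw [T.U_eq_diff, T'.U_eq_diff, ht]
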